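/- (Nishimura lemma.) Let K be a field and f : X ⤏ Y a rational map of K-schemes. Assume that X has a K-rational point x at which X is smooth over K, and that Y is proper over K. Then Y has a K-rational point. -/

import Mathlib

/-!
**Nishimura lemma.** Let `K` be a field and `f : X ⤏ Y` a rational map of `K`-schemes
(a `K`-scheme is a scheme with a structure morphism to `Spec K`, and `f` is a map over `K`
in the sense that some representative partial map commutes with the structure morphisms).
Assume that `X` has a `K`-rational point (a section `x` of the structure morphism) at which
`X` is smooth over `K` (that is, some open neighbourhood of the image of `x` is smooth over
`Spec K`), and that `Y` is proper over `K`. Then `Y` has a `K`-rational point.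
-/

open CategoryTheory AlgebraicGeometry AlgebraicGeometry.Scheme

universe u

open scoped TensorProduct in
/-- If `A` is étale over a domain `P` and the complement of `V(I)` is dense in `Spec A`, then `I`
contains the image of a nonzero element of `P`. -/
theorem Algebra.Etale.exists_ne_zero_algebraMap_mem_of_dense {P A : Type*} [CommRing P]
    [IsDomain P] [CommRing A] [Algebra P A] [Algebra.Etale P A] (I : Ideal A)
    (hI : Dense (PrimeSpectrum.zeroLocus (I : Set A))ᶜ) :
    ∃ g : P, g ≠ 0 ∧ algebraMap P A g ∈ I := by
  let F := FractionRing P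
  let B := F ⊗[P] A
  let M := Algebra.algebraMapSubmonoid A (nonZeroDivisors P)
  let : Algebra A B := Algebra.TensorProduct.rightAlgebra
  have hinj : Function.Injective (algebraMap A B) :=
    Algebra.TensorProduct.includeRight_injective (IsFractionRing.injective P F)
  have : IsLocalization M B := inferInstance
  have : Module.Finite F B := Algebra.FormallyUnramified.finite_of_free F B
  have : IsArtinianRing B := .of_finite F B
  by_contra! H
  have hne : I.map (algebraMap A B) ≠ ⊤ := by
    rw [IsLocalization.map_algebraMap_ne_top_iff_disjoint M, Set.disjoint_left]
    rintro _ ⟨g, hg, rfl⟩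
    exact H g (nonZeroDivisors.ne_zero hg)
  obtain ⟨m, hm, hle⟩ := Ideal.exists_le_maximal _ hne
  obtain ⟨e, hem, -, he⟩ := IsArtinianRing.exists_not_mem_forall_mem_of_ne m
  obtain ⟨⟨a, s⟩, has⟩ := IsLocalization.surj M e
  have ham : algebraMap A B a ∉ m := by
    rw [← has]
    exact hm.isPrime.mul_notMem hem fun h ↦
      hm.ne_top (Ideal.eq_top_of_isUnit_mem _ h (IsLocalization.map_units B s))
  obtain ⟨q, hqI, hqa⟩ := hI.exists_mem_open (PrimeSpectrum.basicOpen a).isOpen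
    ⟨⟨m.comap (algebraMap A B), inferInstance⟩, ham⟩
  obtain ⟨f, hfI, hfq⟩ := Set.not_subset.mp hqI
  have hnil : IsNilpotent (algebraMap A B (a * f)) := by
    rw [nilpotent_iff_mem_prime]
    intro r hr
    rw [map_mul]
    by_cases hrm : r = m
    · exact Ideal.mul_mem_left _ _ (hrm ▸ hle (Ideal.mem_map_of_mem _ hfI))
    · rw [← has]
      exact Ideal.mul_mem_right _ _ (Ideal.mul_mem_right _ _ (he r hr hrm))
  rw [IsNilpotent.map_iff hinj] at hnil
  exact q.2.mul_notMem hqa hfq (nilpotent_iff_mem_prime.mp hnil _ q.2)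

/-- A nonzero polynomial over a field `K` does not vanish at some tuple of power series with
prescribed constant coefficients. -/
theorem MvPolynomial.exists_powerSeries_aeval_ne_zero {K σ : Type*} [Field K]
    {g : MvPolynomial σ K} (hg : g ≠ 0) (c : σ → K) :
    ∃ y : σ → PowerSeries K, (∀ i, (y i).constantCoeff = c i) ∧ aeval y g ≠ 0 := by
  by_contra! H
  refine hg (map_injective _ (algebraMap K (PowerSeries K)).injective ?_)
  refine funext_set (fun i ↦ {y | y.constantCoeff = c i}) (fun i ↦ ?_) fun y hy ↦ ?_
  · refine Set.infinite_of_injective_forall_mem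
      (f := fun k : ℕ ↦ PowerSeries.C (c i) + PowerSeries.X ^ (k + 1)) (fun k l h ↦ ?_) (by simp)
    have := congr_arg (PowerSeries.coeff (k + 1)) h
    simp [PowerSeries.coeff_X_pow] at this
    omega
  · rw [map_zero, map_zero, eval_map, ← aeval_def]
    exact H y fun i ↦ hy i trivial

/-- An étale algebra over an affine space over `K` with a `K`-point has a formal arc avoiding a
given closed subset with dense complement. -/
theorem Algebra.Etale.exists_algHom_powerSeries {K A σ : Type*} [Field K] [CommRing A]
    [Algebra K A] [Algebra (MvPolynomial σ K) A] [IsScalarTower K (MvPolynomial σ K) A]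
    [Algebra.Etale (MvPolynomial σ K) A] (ε : A →ₐ[K] K) (I : Ideal A)
    (hI : Dense (PrimeSpectrum.zeroLocus (I : Set A))ᶜ) :
    ∃ φ : A →ₐ[K] PowerSeries K, ¬ I ≤ RingHom.ker φ := by
  let P := MvPolynomial σ K
  let R := PowerSeries K
  obtain ⟨g, hg0, hgI⟩ := exists_ne_zero_algebraMap_mem_of_dense (P := P) I hI
  obtain ⟨y, hyc, hy⟩ := MvPolynomial.exists_powerSeries_aeval_ne_zero hg0
    fun i ↦ ε (algebraMap P A (MvPolynomial.X i))
  let : Algebra P R := (MvPolynomial.aeval y).toAlgebra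
  let J : Ideal R := Ideal.span {PowerSeries.X}
  let π : A →ₐ[K] R ⧸ J := (Algebra.ofId K (R ⧸ J)).comp ε
  have hπ : π.comp (IsScalarTower.toAlgHom K P A) =
      (Ideal.Quotient.mkₐ K J).comp (MvPolynomial.aeval y) := by
    ext i
    change Ideal.Quotient.mk J (PowerSeries.C (ε (algebraMap P A (MvPolynomial.X i)))) =
      Ideal.Quotient.mk J (MvPolynomial.aeval y (MvPolynomial.X i))
    rw [Ideal.Quotient.eq, Ideal.mem_span_singleton, PowerSeries.X_dvd_iff]
    simp [hyc]
  let f : A →ₐ[P] R ⧸ J := { π.toRingHom with commutes' := fun p ↦ DFunLike.congr_fun hπ p }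
  obtain ⟨φ, -⟩ := Algebra.FormallySmooth.exists_mkₐ_comp_eq_of_isAdicComplete f
  refine ⟨{ φ.toRingHom with commutes' := fun k ↦ ?_ }, fun hle ↦ ?_⟩
  · have h := φ.commutes (MvPolynomial.C k)
    rw [← MvPolynomial.algebraMap_eq, ← IsScalarTower.algebraMap_apply] at h
    exact h.trans ((MvPolynomial.aeval y).commutes k)
  · exact hy ((φ.commutes g).symm.trans (hle hgI))

/-- A smooth `K`-algebra with a `K`-point has a formal arc avoiding a given closed subset with dense
complement. -/
theorem Algebra.Smooth.exists_algHom_powerSeries {K A : Type*} [Field K] [CommRing A]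
    [Algebra K A] [Algebra.Smooth K A] (ε : A →ₐ[K] K) (I : Ideal A)
    (hI : Dense (PrimeSpectrum.zeroLocus (I : Set A))ᶜ) :
    ∃ φ : A →ₐ[K] PowerSeries K, ¬ I ≤ RingHom.ker φ := by
  have := RingHom.ker_isPrime ε
  obtain ⟨f, hf, n, _, _, _⟩ :=
    Algebra.IsSmoothAt.exists_isStandardEtale_mvPolynomial (R := K) (p := RingHom.ker ε)
  let ε' : Localization.Away f →ₐ[K] K :=
    IsLocalization.liftAlgHom (M := .powers f) (f := ε) <| by
      rintro ⟨_, k, rfl⟩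
      simpa using fun h : ε f = 0 ↦ (hf h).elim
  have hdense : Dense
      (PrimeSpectrum.zeroLocus (I.map (algebraMap A (Localization.Away f)) :
        Set (Localization.Away f)))ᶜ := by
    convert hI.preimage (PrimeSpectrum.localization_away_isOpenEmbedding
      (Localization.Away f) f).isOpenMap using 1
    rw [Set.preimage_compl, PrimeSpectrum.preimage_comap_zeroLocus, Ideal.map,
      PrimeSpectrum.zeroLocus_span]
  obtain ⟨φ, hφ⟩ := Algebra.Etale.exists_algHom_powerSeries (σ := Fin n) ε' _ hdense
  exact ⟨φ.comp (IsScalarTower.toAlgHom K A _), fun hle ↦ hφ (Ideal.map_le_iff_le_comap.mpr hle)⟩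

theorem nishimura_lemma {K : Type u} [Field K] {X Y : Scheme.{u}}
    (sX : X ⟶ Spec (CommRingCat.of K)) (sY : Y ⟶ Spec (CommRingCat.of K))
    (f : X ⤏ Y)
    (hfK : ∃ g : X.PartialMap Y, g.toRationalMap = f ∧ g.hom ≫ sY = g.domain.ι ≫ sX)
    (x : Spec (CommRingCat.of K) ⟶ X) (hx : x ≫ sX = 𝟙 _)
    (hxsm : ∃ V : X.Opens, Set.range x.base ⊆ (V : Set X) ∧ IsSmooth (V.ι ≫ sX))
    (hproper : IsProper sY) :
    ∃ y : Spec (CommRingCat.of K) ⟶ Y, y ≫ sY = 𝟙 _ := by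
  obtain ⟨g, -, hg⟩ := hfK
  obtain ⟨V, hxV, hV⟩ := hxsm
  let z : Spec (CommRingCat.of K) := IsLocalRing.closedPoint K
  obtain ⟨W, hW, hxW, hWV⟩ := exists_isAffineOpen_mem_and_subset (U := V) (hxV ⟨z, rfl⟩)
  have : Smooth (hW.fromSpec ≫ sX) := by
    have hle : W ≤ V := hWV
    have : hW.fromSpec ≫ sX = hW.isoSpec.inv ≫ X.homOfLE hle ≫ V.ι ≫ sX := by
      simp [IsAffineOpen.isoSpec_inv_ι_assoc]
    rw [this]
    have : Smooth (V.ι ≫ sX) := hV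
    infer_instance
  obtain ⟨ψ, hψ⟩ := Spec.map_surjective (hW.fromSpec ≫ sX)
  algebraize [ψ.hom]
  have : Algebra.Smooth K Γ(X, W) := by
    rw [← hψ, HasRingHomProperty.Spec_iff (P := @Smooth)] at this
    exact this
  have hrange : Set.range x ⊆ Set.range hW.fromSpec := by
    rw [hW.range_fromSpec]
    rintro _ ⟨w, rfl⟩
    rwa [Subsingleton.elim w z]
  obtain ⟨ε, hε⟩ := Spec.map_surjective (IsOpenImmersion.lift hW.fromSpec x hrange)
  have hψε : ψ ≫ ε = 𝟙 _ := by
    apply Spec.map_injective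
    rw [Spec.map_comp, hε, hψ, IsOpenImmersion.lift_fac_assoc, hx, Spec.map_id]
  obtain ⟨I, hI⟩ := (PrimeSpectrum.isClosed_iff_zeroLocus_ideal _).mp
    (hW.fromSpec ⁻¹ᵁ g.domain).isOpen.isClosed_compl
  have hdense : Dense (PrimeSpectrum.zeroLocus (I : Set Γ(X, W)))ᶜ := by
    rw [compl_eq_comm.mp hI]
    exact g.dense_domain.preimage hW.fromSpec.isOpenEmbedding.isOpenMap
  obtain ⟨φ, hφ⟩ := Algebra.Smooth.exists_algHom_powerSeries
    { ε.hom with commutes' := fun k ↦ DFunLike.congr_fun (congr_arg CommRingCat.Hom.hom hψε) k }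
    I hdense
  let R := PowerSeries K
  let L := FractionRing R
  let ρ : Γ(X, W) ⟶ CommRingCat.of R := CommRingCat.ofHom φ.toRingHom
  let γ : Spec (CommRingCat.of L) ⟶ Spec (CommRingCat.of R) :=
    Spec.map (CommRingCat.ofHom (algebraMap R L))
  have hρ : Spec.map ρ ≫ hW.fromSpec ≫ sX =
      Spec.map (CommRingCat.ofHom (algebraMap K R)) := by
    rw [← hψ, ← Spec.map_comp]
    congr 1
    ext1
    exact RingHom.ext φ.commutes
  have hlands : Set.range (γ ≫ Spec.map ρ ≫ hW.fromSpec) ⊆ Set.range g.domain.ι := by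
    rw [Opens.range_ι]
    rintro _ ⟨w, rfl⟩
    by_contra hw
    have hw' : (γ ≫ Spec.map ρ) w ∈ (↑(hW.fromSpec ⁻¹ᵁ g.domain) : Set _)ᶜ := by
      simpa using hw
    rw [hI] at hw'
    refine hφ fun a ha ↦ ?_
    have h0 : algebraMap R L (φ a) ∈ PrimeSpectrum.asIdeal w := hw' ha
    have hbot : PrimeSpectrum.asIdeal w = ⊥ :=
      @Ideal.eq_bot_of_prime L _ _ (PrimeSpectrum.isPrime w)
    rw [hbot, Ideal.mem_bot] at h0
    exact (map_eq_zero_iff _ (IsFractionRing.injective R L)).mp h0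
  let a := IsOpenImmersion.lift g.domain.ι _ hlands
  let S : ValuativeCommSq sY :=
    { R := R
      K := L
      i₁ := a ≫ g.hom
      i₂ := Spec.map (CommRingCat.ofHom (algebraMap K R))
      commSq := ⟨by
        rw [Category.assoc, hg, IsOpenImmersion.lift_fac_assoc, Category.assoc, Category.assoc, hρ]⟩ }
  have hlift : S.commSq.HasLift := by
    have : ValuativeCriterion sY := by
      have := hproper
      rw [IsProper.eq_valuativeCriterion] at this
      exact this.1.1.1
    exact this.existence S
  refine ⟨Spec.map (CommRingCat.ofHom (PowerSeries.constantCoeff (R := K))) ≫ S.commSq.lift, ?_⟩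
  rw [Category.assoc, S.commSq.fac_right, ← Spec.map_comp, ← Spec.map_id]
  congr 1
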